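/- For every integer k ≥ 2, let w = (w₁, w₂, w₃, w₄) = (2, 2k+1, 2k+1, 2k+1) and d = 4k + 2, and let F(z₁, z₂, z₃, z₄) = z₁^{2k+1} + z₂² + z₃² + z₄² as a polynomial over ℂ. Then: (i) gcd(w₁, w₂, w₃, w₄) = 1; (ii) F is quasi-homogeneous of degree d with respect to w, i.e. F(q^{w₁}z₁, q^{w₂}z₂, q^{w₃}z₃, q^{w₄}z₄) = q^d · F(z₁, z₂, z₃, z₄) for all q, z₁, …, z₄ ∈ ℂ; (iii) the only point of ℂ⁴ at which all four partial derivatives of F vanish is the origin; (iv) |w| − d = w₁ + w₂ + w₃ + w₄ − d = 2k + 3 > 0; and (v) |w| − d > 3 · min(w₁, w₂, w₃, w₄) = 6. Hence there are infinitely many isolated quasi-homogeneous hypersurface singularities satisfying the Fano condition |w| − d > 0 but violating the Lichnerowicz bound |w| − d ≤ n·w_min (here n = 3). -/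

import Mathlib

/-- For every `k ≥ 2`, with weights `w = (2, 2k+1, 2k+1, 2k+1)`, degree
`d = 4k+2` and `F(z) = z₁^{2k+1} + z₂² + z₃² + z₄²`: (i) the weights have gcd `1`;
(ii) `F` is quasi-homogeneous of degree `d` with respect to `w`; (iii) the only common
zero of the four partial derivatives of `F` is the origin; (iv) `|w| − d = 2k + 3 > 0`
(the Fano condition); and (v) `|w| − d > 3·w_min = 6`, violating the Lichnerowicz bound
`|w| − d ≤ n·w_min` with `n = 3`. -/
theorem lichnerowicz_obstructed_hypersurface_singularities
    (k : ℕ) (hk : 2 ≤ k)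
    (F : ℂ → ℂ → ℂ → ℂ → ℂ)
    (hF : F = fun z₁ z₂ z₃ z₄ => z₁ ^ (2 * k + 1) + z₂ ^ 2 + z₃ ^ 2 + z₄ ^ 2) :
    Nat.gcd 2 (Nat.gcd (2 * k + 1) (Nat.gcd (2 * k + 1) (2 * k + 1))) = 1 ∧
    (∀ q z₁ z₂ z₃ z₄ : ℂ,
      F (q ^ 2 * z₁) (q ^ (2 * k + 1) * z₂) (q ^ (2 * k + 1) * z₃) (q ^ (2 * k + 1) * z₄)
        = q ^ (4 * k + 2) * F z₁ z₂ z₃ z₄) ∧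
    (∀ z₁ z₂ z₃ z₄ : ℂ,
      (deriv (fun w => F w z₂ z₃ z₄) z₁ = 0 ∧
       deriv (fun w => F z₁ w z₃ z₄) z₂ = 0 ∧
       deriv (fun w => F z₁ z₂ w z₄) z₃ = 0 ∧
       deriv (fun w => F z₁ z₂ z₃ w) z₄ = 0) →
      (z₁ = 0 ∧ z₂ = 0 ∧ z₃ = 0 ∧ z₄ = 0)) ∧
    ((2 + (2 * k + 1) + (2 * k + 1) + (2 * k + 1)) - (4 * k + 2) = 2 * k + 3 ∧
      0 < 2 * k + 3) ∧
    2 * k + 3 > 3 * min 2 (min (2 * k + 1) (min (2 * k + 1) (2 * k + 1))) := by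
  subst hF
  refine ⟨?_, ?_, ?_, ⟨by omega, by omega⟩, ?_⟩
  · rw [Nat.gcd_self, Nat.gcd_self]
    have h : Nat.Coprime 2 (2 * k + 1) := by
      rw [Nat.coprime_two_left]
      exact ⟨k, rfl⟩
    exact h
  · intro q z₁ z₂ z₃ z₄
    ring
  · intro z₁ z₂ z₃ z₄ h
    obtain ⟨h1, h2, h3, h4⟩ := h
    have hsq : ∀ z : ℂ, HasDerivAt (fun w : ℂ => w ^ 2) (2 * z) z := fun z => by
      simpa using hasDerivAt_pow 2 z
    have e1 := ((((hasDerivAt_pow (2 * k + 1) z₁).add_const (z₂ ^ 2)).add_const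
      (z₃ ^ 2)).add_const (z₄ ^ 2)).deriv
    have e2 := ((((hsq z₂).const_add (z₁ ^ (2 * k + 1))).add_const
      (z₃ ^ 2)).add_const (z₄ ^ 2)).deriv
    have e3 := (((hsq z₃).const_add (z₁ ^ (2 * k + 1) + z₂ ^ 2)).add_const (z₄ ^ 2)).deriv
    have e4 := ((hsq z₄).const_add (z₁ ^ (2 * k + 1) + z₂ ^ 2 + z₃ ^ 2)).deriv
    have f1 := e1.symm.trans h1
    have f2 := e2.symm.trans h2
    have f3 := e3.symm.trans h3
    have f4 := e4.symm.trans h4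
    have hne : ((2 * k + 1 : ℕ) : ℂ) ≠ 0 := Nat.cast_ne_zero.mpr (by omega)
    refine ⟨?_, ?_, ?_, ?_⟩
    · exact eq_zero_of_pow_eq_zero ((mul_eq_zero.mp f1).resolve_left hne)
    · exact (mul_eq_zero.mp f2).resolve_left two_ne_zero
    · exact (mul_eq_zero.mp f3).resolve_left two_ne_zero
    · exact (mul_eq_zero.mp f4).resolve_left two_ne_zero
  · omega
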